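/- arXiv:2402.07084 — 10 statements merged into one kernel-verified Lean document; each statement's English description precedes it below -/
import Mathlib

section
/- Let D ≥ 1. The Gaussian kernel k(x,y) = exp(−‖x−y‖²) on ℝ^D is strictly positive definite: for every N ≥ 1, every family of pairwise distinct points x^1,…,x^N ∈ ℝ^D, and every family of real coefficients c_1,…,c_N that are not all zero, one has Σ_{i=1}^N Σ_{j=1}^N c_i c_j exp(−‖x^i−x^j‖²) > 0. -/
open MeasureTheory

section

variable {E : Type*} [NormedAddCommGroup E] [InnerProductSpace ℝ E]

/-- The exponentials `z ↦ exp ⟪v, z⟫` are linearly independent. -/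
theorem linearIndependent_exp_inner :
    LinearIndependent ℝ (fun v z : E ↦ Real.exp (inner ℝ v z)) := by
  let χ : E → (Multiplicative E →* ℝ) := fun v ↦
    { toFun := fun z ↦ Real.exp (inner ℝ v z.toAdd)
      map_one' := by simp
      map_mul' := fun a b ↦ by simp [inner_add_right, Real.exp_add] }
  have hχ : Function.Injective χ := fun v w h ↦ by
    refine ext_inner_right ℝ fun z ↦ Real.exp_injective ?_
    exact DFunLike.congr_fun h (Multiplicative.ofAdd z)
  exact (linearIndependent_monoidHom (Multiplicative E) ℝ).comp χ hχ

/-- The Gaussians centred at distinct points are linearly independent. -/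
theorem linearIndependent_exp_neg_mul_norm_sub_sq {b : ℝ} (hb : b ≠ 0) :
    LinearIndependent ℝ (fun v z : E ↦ Real.exp (-b * ‖z - v‖ ^ 2)) := by
  rw [linearIndependent_iff']
  intro s g hg v hv
  have hinj : Function.Injective fun v : E ↦ (2 * b) • v :=
    smul_right_injective E (mul_ne_zero two_ne_zero hb)
  have h := linearIndependent_iff'.1 ((linearIndependent_exp_inner (E := E)).comp _ hinj) s
    (fun v ↦ g v * Real.exp (-b * ‖v‖ ^ 2)) ?_ v hv
  · exact (mul_eq_zero.1 h).resolve_right (Real.exp_ne_zero _)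
  · ext z
    have hz := congrFun hg z
    simp only [Finset.sum_apply, Pi.smul_apply, smul_eq_mul, Pi.zero_apply,
      Function.comp_apply] at hz ⊢
    refine (mul_eq_zero.1 (?_ : Real.exp (-b * ‖z‖ ^ 2) * _ = 0)).resolve_left
      (Real.exp_ne_zero _)
    rw [← hz, Finset.mul_sum]
    refine Finset.sum_congr rfl fun w _ ↦ ?_
    rw [mul_assoc, mul_left_comm, ← Real.exp_add, ← Real.exp_add, norm_sub_sq_real,
      real_inner_smul_left, real_inner_comm w z]
    congr 2
    ring

theorem exp_neg_two_mul_norm_sub_sq_mul (x y z : E) :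
    Real.exp (-2 * ‖z - x‖ ^ 2) * Real.exp (-2 * ‖z - y‖ ^ 2) =
      Real.exp (-‖x - y‖ ^ 2) * Real.exp (-4 * ‖z - (2⁻¹ : ℝ) • (x + y)‖ ^ 2) := by
  rw [← Real.exp_add, ← Real.exp_add]
  congr 1
  simp only [norm_sub_sq_real, norm_smul, mul_pow, norm_add_sq_real, real_inner_smul_right,
    inner_add_right]
  norm_num
  ring

variable [FiniteDimensional ℝ E] [MeasurableSpace E] [BorelSpace E]

theorem integral_exp_neg_mul_norm_sq_pos {b : ℝ} (hb : 0 < b) :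
    0 < ∫ z : E, Real.exp (-b * ‖z‖ ^ 2) := by
  rw [GaussianFourier.integral_rexp_neg_mul_sq_norm hb]
  positivity

theorem integrable_exp_mul_exp_norm_sub_sq (x y : E) :
    Integrable fun z : E ↦ Real.exp (-2 * ‖z - x‖ ^ 2) * Real.exp (-2 * ‖z - y‖ ^ 2) := by
  simp_rw [exp_neg_two_mul_norm_sub_sq_mul]
  have h : Integrable fun z : E ↦ Real.exp (-4 * ‖z‖ ^ 2) :=
    .of_integral_ne_zero (integral_exp_neg_mul_norm_sq_pos four_pos).ne'
  exact (h.comp_sub_right _).const_mul _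

/-- The Gaussian kernel is, up to a constant, the `L²` pairing of two narrower Gaussians. -/
theorem integral_exp_mul_exp_norm_sub_sq (x y : E) :
    ∫ z : E, Real.exp (-2 * ‖z - x‖ ^ 2) * Real.exp (-2 * ‖z - y‖ ^ 2) =
      Real.exp (-‖x - y‖ ^ 2) * ∫ z : E, Real.exp (-4 * ‖z‖ ^ 2) := by
  simp_rw [exp_neg_two_mul_norm_sub_sq_mul]
  rw [integral_const_mul, integral_sub_right_eq_self fun z : E ↦ Real.exp (-4 * ‖z‖ ^ 2)]

theorem sum_mul_exp_neg_norm_sub_sq_pos {ι : Type*} [Fintype ι] {x : ι → E}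
    (hx : Function.Injective x) {c : ι → ℝ} (hc : c ≠ 0) :
    0 < ∑ i, ∑ j, c i * c j * Real.exp (-‖x i - x j‖ ^ 2) := by
  let f : E → ℝ := fun z ↦ ∑ i, c i * Real.exp (-2 * ‖z - x i‖ ^ 2)
  have hf_sq (z : E) : f z ^ 2 = ∑ i, ∑ j, c i * c j *
      (Real.exp (-2 * ‖z - x i‖ ^ 2) * Real.exp (-2 * ‖z - x j‖ ^ 2)) := by
    simp only [f, sq (∑ i, _), Finset.sum_mul_sum, mul_mul_mul_comm]
  have hint (i j : ι) : Integrable fun z ↦ c i * c j *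
      (Real.exp (-2 * ‖z - x i‖ ^ 2) * Real.exp (-2 * ‖z - x j‖ ^ 2)) :=
    (integrable_exp_mul_exp_norm_sub_sq (x i) (x j)).const_mul _
  have hf_int : Integrable fun z ↦ f z ^ 2 := by
    simp_rw [hf_sq]
    exact integrable_finsetSum _ fun i _ ↦ integrable_finsetSum _ fun j _ ↦ hint i j
  have hf_integral : ∫ z, f z ^ 2 = (∑ i, ∑ j, c i * c j * Real.exp (-‖x i - x j‖ ^ 2)) *
      ∫ z : E, Real.exp (-4 * ‖z‖ ^ 2) := by
    simp_rw [hf_sq]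
    rw [integral_finsetSum _ fun i _ ↦ integrable_finsetSum _ fun j _ ↦ hint i j,
      Finset.sum_mul]
    refine Finset.sum_congr rfl fun i _ ↦ ?_
    rw [integral_finsetSum _ fun j _ ↦ hint i j, Finset.sum_mul]
    refine Finset.sum_congr rfl fun j _ ↦ ?_
    rw [integral_const_mul, integral_exp_mul_exp_norm_sub_sq, ← mul_assoc]
  obtain ⟨z, hz⟩ : ∃ z, f z ≠ 0 := by
    by_contra! h
    refine hc (funext (Fintype.linearIndependent_iff.1
      ((linearIndependent_exp_neg_mul_norm_sub_sq (E := E) two_ne_zero).comp x hx) c ?_))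
    ext z
    simpa [f] using h z
  refine pos_of_mul_pos_left ?_ (integral_exp_neg_mul_norm_sq_pos (E := E) four_pos).le
  rw [← hf_integral]
  exact integral_pos_of_integrable_nonneg_nonzero (by fun_prop) hf_int
    (fun z ↦ sq_nonneg (f z)) (pow_ne_zero 2 hz)

end

/-- The Gaussian kernel `k(x,y) = exp(-‖x-y‖²)` on `ℝ^D` is strictly positive definite. -/
theorem stmt_1 (D : ℕ) (hD : 1 ≤ D) (N : ℕ) (hN : 1 ≤ N)
    (x : Fin N → EuclideanSpace ℝ (Fin D)) (hx : Function.Injective x)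
    (c : Fin N → ℝ) (hc : c ≠ 0) :
    0 < ∑ i, ∑ j, c i * c j * Real.exp (-‖x i - x j‖ ^ 2) :=
  sum_mul_exp_neg_norm_sub_sq_pos hx hc
end

section
/- Let D ≥ 1. The Matérn (Laplace) kernel k(x,y) = exp(−‖x−y‖) on ℝ^D is strictly positive definite: for every N ≥ 1, every family of pairwise distinct points x^1,…,x^N ∈ ℝ^D, and every family of real coefficients c_1,…,c_N that are not all zero, one has Σ_{i=1}^N Σ_{j=1}^N c_i c_j exp(−‖x^i−x^j‖) > 0. -/
open MeasureTheory ProbabilityTheory Filter Topology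

/-- The Gaussian kernel is positive semidefinite, by its representation as a characteristic
function. -/
theorem gaussian_kernel_nonneg {E ι : Type*} [NormedAddCommGroup E] [InnerProductSpace ℝ E]
    [FiniteDimensional ℝ E] [Fintype ι] (p : ι → E) (c : ι → ℝ) :
    0 ≤ ∑ i, ∑ j, c i * c j * Real.exp (-(‖p i - p j‖ ^ 2 / 2)) := by
  borelize E
  have hint (t : E) : Integrable (fun x : E ↦ Real.cos (inner ℝ x t)) (stdGaussian E) := by
    refine Integrable.of_bound (C := 1) (by fun_prop) (ae_of_all _ fun x ↦ ?_)
    simpa using Real.abs_cos_le_one _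
  have hcos (t : E) :
      Real.exp (-(‖t‖ ^ 2 / 2)) = ∫ x, Real.cos (inner ℝ x t) ∂(stdGaussian E) := by
    have h := charFun_stdGaussian t
    rw [charFun_apply] at h
    have hI : Integrable (fun x : E ↦ Complex.exp (↑(inner ℝ x t) * Complex.I))
        (stdGaussian E) := by
      refine Integrable.of_bound (C := 1) (by fun_prop) (ae_of_all _ fun x ↦ ?_)
      rw [Complex.norm_exp_ofReal_mul_I]
    have h' := congrArg Complex.re h
    have hre := integral_re hI
    simp only [RCLike.re_eq_complex_re, Complex.exp_ofReal_mul_I_re] at hre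
    rw [← hre] at h'
    rw [h', ← Complex.exp_ofReal_re]
    push_cast
    rw [neg_div]
  have hterm (i j : ι) : c i * c j * Real.exp (-(‖p i - p j‖ ^ 2 / 2))
      = ∫ x, c i * c j * Real.cos (inner ℝ x (p i - p j)) ∂(stdGaussian E) := by
    rw [hcos, integral_const_mul]
  simp_rw [hterm]
  have hI (i j : ι) : Integrable (fun x : E ↦ c i * c j * Real.cos (inner ℝ x (p i - p j)))
      (stdGaussian E) := (hint _).const_mul _
  simp_rw [← integral_finsetSum _ fun j _ ↦ hI _ j]
  rw [← integral_finsetSum _ fun i _ ↦ integrable_finsetSum _ fun j _ ↦ hI i j]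
  refine integral_nonneg fun x ↦ ?_
  have hsq : ∑ i, ∑ j, c i * c j * Real.cos (inner ℝ x (p i - p j))
      = (∑ i, c i * Real.cos (inner ℝ x (p i))) ^ 2
        + (∑ i, c i * Real.sin (inner ℝ x (p i))) ^ 2 := by
    simp_rw [sq, Finset.sum_mul_sum, ← Finset.sum_add_distrib]
    refine Finset.sum_congr rfl fun i _ ↦ Finset.sum_congr rfl fun j _ ↦ ?_
    rw [inner_sub_right, Real.cos_sub]
    ring
  simp only [Pi.zero_apply, hsq]
  positivity

theorem image_sub_div_Ioi {a : ℝ} (ha : 0 < a) :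
    (fun s : ℝ ↦ s - a / s) '' Set.Ioi 0 = Set.univ := by
  refine Set.eq_univ_of_forall fun y ↦ ?_
  have hr : 0 ≤ y ^ 2 + 4 * a := by positivity
  have hlt : |y| < √(y ^ 2 + 4 * a) := by
    rw [← Real.sqrt_sq_eq_abs]
    exact Real.sqrt_lt_sqrt (sq_nonneg y) (by linarith)
  have hpos : 0 < (y + √(y ^ 2 + 4 * a)) / 2 := by
    linarith [neg_abs_le y]
  refine ⟨_, hpos, ?_⟩
  have h2 := Real.sq_sqrt hr
  simp only
  rw [sub_eq_iff_eq_add, ← sub_eq_iff_eq_add', eq_div_iff hpos.ne']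
  linear_combination h2 / 4

theorem image_div_Ioi {a : ℝ} (ha : 0 < a) :
    (fun s : ℝ ↦ a / s) '' Set.Ioi 0 = Set.Ioi 0 := by
  ext y
  constructor
  · rintro ⟨s, hs, rfl⟩
    exact div_pos ha hs
  · intro hy
    exact ⟨a / y, div_pos ha hy, div_div_cancel₀ ha.ne'⟩

/-- The Cauchy–Schlömilch transformation of the Gaussian integral. -/
theorem integral_exp_neg_sub_div_sq {a : ℝ} (ha : 0 < a) :
    ∫ s in Set.Ioi (0 : ℝ), Real.exp (-(s - a / s) ^ 2) = √Real.pi / 2 := by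
  have hd1 : ∀ s ∈ Set.Ioi (0 : ℝ),
      HasDerivWithinAt (fun s : ℝ ↦ s - a / s) (1 + a / s ^ 2) (Set.Ioi 0) s := fun s hs ↦ by
    have h := (hasDerivAt_id s).sub ((hasDerivAt_inv (ne_of_gt hs)).const_mul a)
    refine (h.congr_deriv ?_).hasDerivWithinAt
    ring
  have hd2 : ∀ s ∈ Set.Ioi (0 : ℝ),
      HasDerivWithinAt (fun s : ℝ ↦ a / s) (-(a / s ^ 2)) (Set.Ioi 0) s := fun s hs ↦ by
    have h := (hasDerivAt_inv (ne_of_gt hs)).const_mul a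
    refine (h.congr_deriv ?_).hasDerivWithinAt
    ring
  have hi1 : Set.InjOn (fun s : ℝ ↦ s - a / s) (Set.Ioi 0) := by
    have : StrictMonoOn (fun s : ℝ ↦ s - a / s) (Set.Ioi 0) := fun s hs t ht hst ↦
      sub_lt_sub hst (div_lt_div_of_pos_left ha hs hst)
    exact this.injOn
  have hi2 : Set.InjOn (fun s : ℝ ↦ a / s) (Set.Ioi 0) := by
    have : StrictAntiOn (fun s : ℝ ↦ a / s) (Set.Ioi 0) := fun s hs t ht hst ↦
      div_lt_div_of_pos_left ha hs hst
    exact this.injOn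
  have hg : ∫ x : ℝ, Real.exp (-x ^ 2) = √Real.pi := by
    simpa using integral_gaussian 1
  have hgi : Integrable fun x : ℝ ↦ Real.exp (-x ^ 2) := by
    simpa using integrable_exp_neg_mul_sq one_pos
  have e1 := integral_image_eq_integral_abs_deriv_smul measurableSet_Ioi hd1 hi1
    (fun x ↦ Real.exp (-x ^ 2))
  have i1 := integrableOn_image_iff_integrableOn_abs_deriv_smul measurableSet_Ioi hd1 hi1
    (fun x ↦ Real.exp (-x ^ 2))
  have e2 := integral_image_eq_integral_abs_deriv_smul measurableSet_Ioi hd2 hi2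
    (fun s ↦ Real.exp (-(s - a / s) ^ 2))
  rw [image_sub_div_Ioi ha] at e1 i1
  rw [image_div_Ioi ha] at e2
  rw [setIntegral_univ, hg] at e1
  have i1' := i1.1 hgi.integrableOn
  have hsplit : ∀ s ∈ Set.Ioi (0 : ℝ), |1 + a / s ^ 2| • Real.exp (-(s - a / s) ^ 2)
      = Real.exp (-(s - a / s) ^ 2) + a / s ^ 2 * Real.exp (-(s - a / s) ^ 2) := fun s hs ↦ by
    rw [abs_of_pos (by positivity), smul_eq_mul]
    ring
  have hflip : ∀ s ∈ Set.Ioi (0 : ℝ),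
      |-(a / s ^ 2)| • Real.exp (-(a / s - a / (a / s)) ^ 2)
        = a / s ^ 2 * Real.exp (-(s - a / s) ^ 2) := fun s hs ↦ by
    rw [abs_neg, abs_of_nonneg (by positivity), smul_eq_mul, div_div_cancel₀ ha.ne',
      ← neg_sub s, neg_sq]
  rw [setIntegral_congr_fun measurableSet_Ioi hflip] at e2
  rw [setIntegral_congr_fun measurableSet_Ioi hsplit] at e1
  rw [integrableOn_congr_fun hsplit measurableSet_Ioi] at i1'
  have hA : IntegrableOn (fun s : ℝ ↦ Real.exp (-(s - a / s) ^ 2)) (Set.Ioi 0) := by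
    refine Integrable.mono' i1' (by fun_prop) (ae_of_all _ fun s ↦ ?_)
    rw [Real.norm_of_nonneg (Real.exp_nonneg _)]
    exact le_add_of_nonneg_right (by positivity)
  have hB : IntegrableOn (fun s : ℝ ↦ a / s ^ 2 * Real.exp (-(s - a / s) ^ 2)) (Set.Ioi 0) := by
    refine (i1'.sub hA).congr (ae_of_all _ fun s ↦ ?_)
    simp
  rw [integral_add hA hB, ← e2] at e1
  linarith

/-- The exponential as a mixture of Gaussians. -/
theorem integral_exp_neg_sq_mul_exp_neg_div_sq {r : ℝ} (hr : 0 ≤ r) :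
    ∫ s in Set.Ioi (0 : ℝ), Real.exp (-s ^ 2) * Real.exp (-(r / (2 * s)) ^ 2)
      = √Real.pi / 2 * Real.exp (-r) := by
  rcases hr.eq_or_lt with rfl | hr
  · simpa using integral_gaussian_Ioi 1
  · rw [← integral_exp_neg_sub_div_sq (half_pos hr), ← integral_mul_const]
    refine setIntegral_congr_fun measurableSet_Ioi fun s hs ↦ ?_
    have hs' : s ≠ 0 := ne_of_gt hs
    simp only [← Real.exp_add]
    congr 1
    field_simp
    ring

theorem tendsto_exp_neg_div_sq {r : ℝ} (hr : 0 < r) :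
    Tendsto (fun s : ℝ ↦ Real.exp (-(r / (2 * s)) ^ 2)) (𝓝[>] 0) (𝓝 0) := by
  have h1 : Tendsto (fun s : ℝ ↦ r / 2 * s⁻¹) (𝓝[>] 0) atTop :=
    tendsto_inv_nhdsGT_zero.const_mul_atTop (half_pos hr)
  have h2 := Real.tendsto_exp_neg_atTop_nhds_zero.comp
    ((tendsto_pow_atTop (two_ne_zero)).comp h1)
  refine h2.congr fun s ↦ ?_
  simp only [Function.comp_apply]
  congr 3
  ring

/-- The Matérn (Laplace) kernel `k(x,y) = exp(-‖x-y‖)` on `ℝ^D` is strictly positive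
definite. -/
theorem stmt_2 (D : ℕ) (hD : 1 ≤ D) (N : ℕ) (hN : 1 ≤ N)
    (x : Fin N → EuclideanSpace ℝ (Fin D)) (hx : Function.Injective x)
    (c : Fin N → ℝ) (hc : c ≠ 0) :
    0 < ∑ i, ∑ j, c i * c j * Real.exp (-‖x i - x j‖) := by
  set q : ℝ → ℝ := fun s ↦
    ∑ i, ∑ j, c i * c j * Real.exp (-(‖x i - x j‖ / (2 * s)) ^ 2) with hq
  have hgi : IntegrableOn (fun s : ℝ ↦ Real.exp (-s ^ 2)) (Set.Ioi 0) := by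
    simpa using (integrable_exp_neg_mul_sq one_pos).integrableOn
  have hI (i j : Fin N) : IntegrableOn (fun s : ℝ ↦ c i * c j *
      (Real.exp (-s ^ 2) * Real.exp (-(‖x i - x j‖ / (2 * s)) ^ 2))) (Set.Ioi 0) := by
    refine Integrable.const_mul (Integrable.mono' hgi (by fun_prop) (ae_of_all _ fun s ↦ ?_)) _
    rw [Real.norm_of_nonneg (by positivity)]
    refine mul_le_of_le_one_right (Real.exp_nonneg _) (Real.exp_le_one_iff.2 ?_)
    exact neg_nonpos.2 (sq_nonneg _)
  have hmul (s : ℝ) : Real.exp (-s ^ 2) * q s = ∑ i, ∑ j, c i * c j *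
      (Real.exp (-s ^ 2) * Real.exp (-(‖x i - x j‖ / (2 * s)) ^ 2)) := by
    simp only [hq, Finset.mul_sum]
    exact Finset.sum_congr rfl fun i _ ↦ Finset.sum_congr rfl fun j _ ↦ by ring
  have hQI : IntegrableOn (fun s ↦ Real.exp (-s ^ 2) * q s) (Set.Ioi 0) := by
    simp_rw [hmul]
    exact integrable_finsetSum _ fun i _ ↦ integrable_finsetSum _ fun j _ ↦ hI i j
  have hQ : ∫ s in Set.Ioi (0 : ℝ), Real.exp (-s ^ 2) * q s
      = √Real.pi / 2 * ∑ i, ∑ j, c i * c j * Real.exp (-‖x i - x j‖) := by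
    simp_rw [hmul]
    rw [integral_finsetSum _ fun i _ ↦ integrable_finsetSum _ fun j _ ↦ hI i j, Finset.mul_sum]
    refine Finset.sum_congr rfl fun i _ ↦ ?_
    rw [integral_finsetSum _ fun j _ ↦ hI i j, Finset.mul_sum]
    refine Finset.sum_congr rfl fun j _ ↦ ?_
    rw [integral_const_mul, integral_exp_neg_sq_mul_exp_neg_div_sq (norm_nonneg _)]
    ring
  have hq_nonneg (s : ℝ) : 0 ≤ q s := by
    have h := gaussian_kernel_nonneg (fun i ↦ (√2 * (2 * s)⁻¹) • x i) c
    refine h.trans_eq ?_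
    refine Finset.sum_congr rfl fun i _ ↦ Finset.sum_congr rfl fun j _ ↦ ?_
    rw [← smul_sub, norm_smul, mul_pow, Real.norm_eq_abs, sq_abs, mul_pow,
      Real.sq_sqrt zero_le_two]
    congr 2
    ring
  have hlim : Tendsto q (𝓝[>] 0) (𝓝 (∑ i, ∑ j, c i * c j * if i = j then 1 else 0)) := by
    refine tendsto_finsetSum _ fun i _ ↦ tendsto_finsetSum _ fun j _ ↦ ?_
    refine Tendsto.const_mul _ ?_
    split_ifs with hij
    · subst hij
      simp
    · exact tendsto_exp_neg_div_sq (norm_pos_iff.2 (sub_ne_zero.2 (hx.ne hij)))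
  have hlim_pos : 0 < ∑ i, ∑ j, c i * c j * if i = j then (1 : ℝ) else 0 := by
    obtain ⟨k, hk⟩ := Function.ne_iff.1 hc
    simp only [mul_ite, mul_one, mul_zero, Finset.sum_ite_eq, Finset.mem_univ, if_true]
    exact Finset.sum_pos' (fun i _ ↦ mul_self_nonneg _)
      ⟨k, Finset.mem_univ k, mul_self_pos.2 hk⟩
  obtain ⟨ε, hε, hsub⟩ := mem_nhdsGT_iff_exists_Ioo_subset.1
    (hlim.eventually (lt_mem_nhds hlim_pos))
  have hpos : 0 < ∫ s in Set.Ioi (0 : ℝ), Real.exp (-s ^ 2) * q s := by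
    rw [setIntegral_pos_iff_support_of_nonneg_ae
      (ae_of_all _ fun s ↦ mul_nonneg (Real.exp_nonneg _) (hq_nonneg s)) hQI]
    refine lt_of_lt_of_le ?_ (measure_mono (s := Set.Ioo 0 ε) fun s hs ↦ ⟨?_, hs.1⟩)
    · simpa using hε
    · exact (mul_pos (Real.exp_pos _) (hsub hs)).ne'
  rw [hQ] at hpos
  exact pos_of_mul_pos_right hpos (by positivity)
end

section
/- The tent (ReLU-type) kernel k(x,y) = max(1 − |x−y|, 0) on ℝ is positive semidefinite: for every N ≥ 1, all points x^1,…,x^N ∈ ℝ, and all real coefficients c_1,…,c_N, one has Σ_{i=1}^N Σ_{j=1}^N c_i c_j max(1 − |x^i−x^j|, 0) ≥ 0. -/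
open MeasureTheory in
/-- The tent function is the overlap length of two unit intervals. -/
theorem volume_real_Icc_inter_Icc_add_one (a b : ℝ) :
    volume.real (Set.Icc a (a + 1) ∩ Set.Icc b (b + 1)) = max (1 - |a - b|) 0 := by
  rw [Set.Icc_inter_Icc, Real.volume_real_Icc]
  congr 1
  rcases le_total a b with h | h
  · rw [sup_eq_right.2 h, inf_eq_left.2 (by linarith), abs_of_nonpos (by linarith)]
    ring
  · rw [sup_eq_left.2 h, inf_eq_right.2 (by linarith), abs_of_nonneg (by linarith)]
    ring

open MeasureTheory in
/-- The Gram form of finitely many measurable sets of finite measure is nonnegative. -/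
theorem sum_sum_mul_measureReal_inter_nonneg {α ι : Type*} [MeasurableSpace α] [Fintype ι]
    (μ : Measure α) (s : ι → Set α) (hs : ∀ i, MeasurableSet (s i)) (hμ : ∀ i, μ (s i) ≠ ⊤)
    (c : ι → ℝ) : 0 ≤ ∑ i, ∑ j, c i * c j * μ.real (s i ∩ s j) := by
  have hint (i j : ι) :
      Integrable (fun t ↦ c i * c j * (s i ∩ s j).indicator (fun _ ↦ (1 : ℝ)) t) μ :=
    ((integrable_indicator_iff ((hs i).inter (hs j))).2
      (integrableOn_const (measure_ne_top_of_subset Set.inter_subset_left (hμ i)))).const_mul _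
  have hsq : ∑ i, ∑ j, c i * c j * μ.real (s i ∩ s j)
      = ∫ t, (∑ i, c i * (s i).indicator (fun _ ↦ (1 : ℝ)) t) ^ 2 ∂μ := by
    calc ∑ i, ∑ j, c i * c j * μ.real (s i ∩ s j)
        = ∫ t, ∑ i, ∑ j, c i * c j * (s i ∩ s j).indicator (fun _ ↦ (1 : ℝ)) t ∂μ := by
          rw [integral_finsetSum _ fun i _ ↦ integrable_finsetSum _ fun j _ ↦ hint i j]
          refine Finset.sum_congr rfl fun i _ ↦ ?_
          rw [integral_finsetSum _ fun j _ ↦ hint i j]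
          refine Finset.sum_congr rfl fun j _ ↦ ?_
          rw [integral_const_mul, integral_indicator ((hs i).inter (hs j))]
          simp
      _ = _ := by
          congr 1 with t
          rw [sq, Finset.sum_mul_sum]
          refine Finset.sum_congr rfl fun i _ ↦ Finset.sum_congr rfl fun j _ ↦ ?_
          by_cases hi : t ∈ s i <;> by_cases hj : t ∈ s j <;> simp [hi, hj]
  rw [hsq]
  exact integral_nonneg fun t ↦ sq_nonneg _

/-- The tent (ReLU-type) kernel `k(x,y) = max(1 - |x-y|, 0)` on `ℝ` is positive
semidefinite. -/
theorem stmt_3 (N : ℕ) (hN : 1 ≤ N) (x : Fin N → ℝ) (c : Fin N → ℝ) :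
    0 ≤ ∑ i, ∑ j, c i * c j * max (1 - |x i - x j|) 0 := by
  simp_rw [← volume_real_Icc_inter_Icc_add_one]
  exact sum_sum_mul_measureReal_inter_nonneg _ (fun i ↦ Set.Icc (x i) (x i + 1))
    (fun _ ↦ measurableSet_Icc) (fun _ ↦ measure_Icc_lt_top.ne) c
end

section
/- The sinus-cardinal kernel k(x,y) = sin(x−y)/(x−y) (with the convention k(x,x) = 1) on ℝ is positive semidefinite: for every N ≥ 1, all points x^1,…,x^N ∈ ℝ, and all real coefficients c_1,…,c_N, one has Σ_{i=1}^N Σ_{j=1}^N c_i c_j k(x^i,x^j) ≥ 0. -/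
theorem Real.integral_cos_mul_eq_sinc (r : ℝ) :
    ∫ t in (0 : ℝ)..1, Real.cos (r * t) = Real.sinc r := by
  rcases eq_or_ne r 0 with rfl | hr
  · simp
  · rw [intervalIntegral.integral_comp_mul_left _ hr, Real.sinc_of_ne_zero hr]
    simp [div_eq_inv_mul]

theorem sum_sum_mul_cos_sub_nonneg {ι : Type*} [Fintype ι] (c θ : ι → ℝ) :
    0 ≤ ∑ i, ∑ j, c i * c j * Real.cos (θ i - θ j) := by
  have h : ∑ i, ∑ j, c i * c j * Real.cos (θ i - θ j) =
      (∑ i, c i * Real.cos (θ i)) ^ 2 + (∑ i, c i * Real.sin (θ i)) ^ 2 := by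
    simp_rw [sq, Finset.sum_mul_sum, ← Finset.sum_add_distrib, Real.cos_sub]
    refine Finset.sum_congr rfl fun i _ => Finset.sum_congr rfl fun j _ => ?_
    ring
  rw [h]
  positivity

theorem sum_sum_mul_sinc_sub_nonneg {ι : Type*} [Fintype ι] (c x : ι → ℝ) :
    0 ≤ ∑ i, ∑ j, c i * c j * Real.sinc (x i - x j) := by
  have h : ∑ i, ∑ j, c i * c j * Real.sinc (x i - x j) =
      ∫ t in (0 : ℝ)..1, ∑ i, ∑ j, c i * c j * Real.cos (x i * t - x j * t) := by
    simp_rw [← sub_mul]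
    rw [intervalIntegral.integral_finsetSum fun i _ =>
      Continuous.intervalIntegrable (by fun_prop) _ _]
    refine Finset.sum_congr rfl fun i _ => ?_
    rw [intervalIntegral.integral_finsetSum fun j _ =>
      Continuous.intervalIntegrable (by fun_prop) _ _]
    simp_rw [intervalIntegral.integral_const_mul, Real.integral_cos_mul_eq_sinc]
  rw [h]
  exact intervalIntegral.integral_nonneg zero_le_one fun t _ =>
    sum_sum_mul_cos_sub_nonneg c fun i => x i * t


/-- The sinus-cardinal kernel `k(x,y) = sin(x-y)/(x-y)` (with `k(x,x) = 1`) on `ℝ` is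
positive semidefinite. -/
theorem stmt_4 (k : ℝ → ℝ → ℝ)
    (hk : ∀ x y, k x y = if x = y then 1 else Real.sin (x - y) / (x - y))
    (N : ℕ) (hN : 1 ≤ N) (x : Fin N → ℝ) (c : Fin N → ℝ) :
    0 ≤ ∑ i, ∑ j, c i * c j * k (x i) (x j) := by
  have h (y z : ℝ) : k y z = Real.sinc (y - z) := by
    rw [hk, Real.sinc_apply]
    simp only [sub_eq_zero]
  simp_rw [h]
  exact sum_sum_mul_sinc_sub_nonneg c x
end

section
/- Let k : ℝ^D × ℝ^D → ℝ be a symmetric positive semidefinite kernel, let X = (x^1,…,x^N) be points in ℝ^D whose Gram matrix K = (k(x^i,x^j))_{i,j=1}^N is invertible, and let f = Σ_{j=1}^M c_j k(·, w^j) with w^1,…,w^M ∈ ℝ^D and c ∈ ℝ^M. Let f_k be the kernel interpolant of f on X. Then for every z ∈ ℝ^D, (f(z) − f_k(z))² ≤ d_k(X,z)² · ‖f‖_k², where d_k(X,z)² = (1/N²) Σ_{i,j=1}^N k(x^i,x^j) + k(z,z) − (2/N) Σ_{i=1}^N k(x^i,z) and ‖f‖_k² = Σ_{i,j=1}^M c_i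 c_j k(w^i,w^j). -/
open Finsupp in
/-- The bilinear form on finitely supported coefficient families induced by a kernel. -/
noncomputable def kernelBilin {E : Type*} (k : E → E → ℝ) : LinearMap.BilinForm ℝ (E →₀ ℝ) :=
  linearCombination ℝ fun p => linearCombination ℝ fun q => k p q

@[simp]
theorem kernelBilin_single_single {E : Type*} (k : E → E → ℝ) (p q : E) (a b : ℝ) :
    kernelBilin k (Finsupp.single p a) (Finsupp.single q b) = a * b * k p q := by
  simp [kernelBilin, mul_assoc]

theorem kernelBilin_self {E : Type*} (k : E → E → ℝ) (u : E →₀ ℝ) :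
    kernelBilin k u u = ∑ p ∈ u.support, ∑ q ∈ u.support, u p * u q * k p q := by
  simp [kernelBilin, Finsupp.linearCombination_apply, Finsupp.sum, Finset.mul_sum, mul_assoc]

theorem kernelBilin_comm {E : Type*} {k : E → E → ℝ} (hsymm : ∀ x y, k x y = k y x)
    (u v : E →₀ ℝ) : kernelBilin k u v = kernelBilin k v u := by
  simp only [kernelBilin, Finsupp.linearCombination_apply, Finsupp.sum, LinearMap.sum_apply,
    LinearMap.smul_apply, smul_eq_mul, Finset.mul_sum]
  rw [Finset.sum_comm]
  refine Finset.sum_congr rfl fun q _ => Finset.sum_congr rfl fun p _ => ?_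
  rw [hsymm p q]
  ring

theorem kernelBilin_self_nonneg {E : Type*} {k : E → E → ℝ}
    (hpsd : ∀ (P : ℕ) (p : Fin P → E) (c : Fin P → ℝ),
      0 ≤ ∑ i, ∑ j, c i * c j * k (p i) (p j)) (u : E →₀ ℝ) :
    0 ≤ kernelBilin k u u := by
  have e := u.support.equivFin.symm
  have h := hpsd _ (fun i => (e i : E)) (fun i => u (e i))
  rw [e.sum_comp fun p : u.support => ∑ j, u p * u (e j) * k p (e j)] at h
  simp_rw [fun p : u.support => e.sum_comp fun q : u.support => u p * u q * k p q] at h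
  rw [kernelBilin_self, ← Finset.sum_coe_sort u.support]
  simpa only [← Finset.sum_coe_sort u.support] using h

theorem kernelBilin_sq_le {E : Type*} {k : E → E → ℝ} (hsymm : ∀ x y, k x y = k y x)
    (hpsd : ∀ (P : ℕ) (p : Fin P → E) (c : Fin P → ℝ),
      0 ≤ ∑ i, ∑ j, c i * c j * k (p i) (p j)) (u v : E →₀ ℝ) :
    kernelBilin k u v ^ 2 ≤ kernelBilin k u u * kernelBilin k v v := by
  have h := LinearMap.BilinForm.apply_mul_apply_le_of_forall_zero_le (kernelBilin k)
    (kernelBilin_self_nonneg hpsd) u v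
  rwa [kernelBilin_comm hsymm v u, ← sq] at h

/-- Pointwise error estimate for kernel interpolation: `(f(z) - f_k(z))² ≤ d_k(X,z)² ‖f‖_k²`,
where `f` lies in the span of kernel translates, `f_k` is its kernel interpolant on `X`,
`d_k(X,z)` is the kernel discrepancy between `X` and the single point `z`, and `‖f‖_k` is
the kernel norm of `f`. -/
theorem stmt_6 (D N M : ℕ) (hN : 0 < N)
    (k : EuclideanSpace ℝ (Fin D) → EuclideanSpace ℝ (Fin D) → ℝ)
    (hsymm : ∀ x y, k x y = k y x)
    (hpsd : ∀ (P : ℕ) (p : Fin P → EuclideanSpace ℝ (Fin D)) (c : Fin P → ℝ),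
      0 ≤ ∑ i, ∑ j, c i * c j * k (p i) (p j))
    (x : Fin N → EuclideanSpace ℝ (Fin D))
    (w : Fin M → EuclideanSpace ℝ (Fin D)) (c : Fin M → ℝ)
    (K : Matrix (Fin N) (Fin N) ℝ) (hK : ∀ i j, K i j = k (x i) (x j))
    (hKinv : IsUnit K.det)
    (f : EuclideanSpace ℝ (Fin D) → ℝ) (hf : ∀ z, f z = ∑ j, c j * k z (w j))
    (a : Fin N → ℝ) (ha : a = K⁻¹.mulVec fun i => f (x i))
    (fk : EuclideanSpace ℝ (Fin D) → ℝ) (hfk : ∀ z, fk z = ∑ i, a i * k z (x i))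
    (z : EuclideanSpace ℝ (Fin D)) :
    (f z - fk z) ^ 2 ≤
      ((1 / (N : ℝ) ^ 2) * (∑ i, ∑ j, k (x i) (x j)) + k z z
          - (2 / (N : ℝ)) * ∑ i, k (x i) z)
        * ∑ i, ∑ j, c i * c j * k (w i) (w j) := by
  set B := kernelBilin k with hB
  set F : EuclideanSpace ℝ (Fin D) →₀ ℝ := ∑ j, Finsupp.single (w j) (c j) with hF
  set A : EuclideanSpace ℝ (Fin D) →₀ ℝ := ∑ i, Finsupp.single (x i) (a i) with hA
  set S : EuclideanSpace ℝ (Fin D) →₀ ℝ := ∑ i, Finsupp.single (x i) 1 with hS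
  set μ : EuclideanSpace ℝ (Fin D) →₀ ℝ := Finsupp.single z 1 - (1 / (N : ℝ)) • S with hμ
  have hFp (p) (b : ℝ) : B F (Finsupp.single p b) = b * f p := by
    simp only [hB, hF, map_sum, LinearMap.sum_apply, kernelBilin_single_single, hf, Finset.mul_sum]
    exact Finset.sum_congr rfl fun j _ => by rw [hsymm]; ring
  have hAp (p) (b : ℝ) : B A (Finsupp.single p b) = b * fk p := by
    simp only [hB, hA, map_sum, LinearMap.sum_apply, kernelBilin_single_single, hfk, Finset.mul_sum]
    exact Finset.sum_congr rfl fun j _ => by rw [hsymm]; ring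
  have hinterp (i) : fk (x i) = f (x i) := by
    have h : K.mulVec a = fun i => f (x i) := by
      rw [ha, Matrix.mulVec_mulVec, Matrix.mul_nonsing_inv K hKinv, Matrix.one_mulVec]
    rw [hfk, ← congrFun h i]
    simp only [Matrix.mulVec, dotProduct, hK, mul_comm]
  have hGx (b : Fin N → ℝ) : B (F - A) (∑ i, Finsupp.single (x i) (b i)) = 0 := by
    simp [hFp, hAp, hinterp]
  have hGμ : B (F - A) μ = f z - fk z := by
    rw [hμ, map_sub, map_smul, hGx fun _ => 1]
    simp [hFp, hAp]
  have hμμ : B μ μ = (1 / (N : ℝ) ^ 2) * (∑ i, ∑ j, k (x i) (x j)) + k z z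
      - (2 / (N : ℝ)) * ∑ i, k (x i) z := by
    have hSS : B S S = ∑ i, ∑ j, k (x i) (x j) := by
      rw [hB, hS]
      simp only [map_sum, LinearMap.sum_apply, kernelBilin_single_single, one_mul]
      exact Finset.sum_comm
    have hSz : B S (Finsupp.single z 1) = ∑ i, k (x i) z := by
      simp [hB, hS]
    have hzS : B (Finsupp.single z 1) S = ∑ i, k (x i) z := by
      rw [hB, kernelBilin_comm hsymm, ← hB, hSz]
    have hzz : B (Finsupp.single z 1) (Finsupp.single z 1) = k z z := by simp [hB]
    simp only [hμ, map_sub, map_smul, LinearMap.sub_apply, LinearMap.smul_apply, smul_eq_mul,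
      hSS, hSz, hzS, hzz]
    ring
  have hFF : B F F = ∑ i, ∑ j, c i * c j * k (w i) (w j) := by
    rw [hB, hF]
    simp only [map_sum, LinearMap.sum_apply, kernelBilin_single_single]
    exact Finset.sum_comm
  have hGF : B (F - A) (F - A) ≤ B F F := by
    have hGA : B (F - A) A = 0 := hGx a
    have hAA : 0 ≤ B A A := kernelBilin_self_nonneg hpsd A
    have hcomm : B A F = B F A := kernelBilin_comm hsymm A F
    simp only [map_sub, LinearMap.sub_apply] at hGA ⊢
    linarith
  rw [← hGμ, ← hμμ, ← hFF, mul_comm]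
  exact (kernelBilin_sq_le hsymm hpsd (F - A) μ).trans
    (mul_le_mul_of_nonneg_right hGF (kernelBilin_self_nonneg hpsd μ))
end

section
/- Let k : ℝ^D × ℝ^D → ℝ be a symmetric positive semidefinite kernel, let X = (x^1,…,x^N) be points in ℝ^D whose Gram matrix K = (k(x^i,x^j))_{i,j=1}^N is invertible, and let f = Σ_{j=1}^M c_j k(·, w^j) with w^1,…,w^M ∈ ℝ^D and c ∈ ℝ^M. Let f_k be the kernel interpolant of f on X. Then for every finite tuple Z = (z^1,…,z^{N_z}) of points in ℝ^D, ( (1/N_z) Σ_{n=1}^{N_z} (f(z^n) − f_k(z^n)) )² ≤ d_k(X,Z)² · ‖f‖_k², where d_k(X,Z)² is the squared kernel discrepancy between X and Z and ‖f‖_k² = Σ_{i,j=1}^M c_i c_j k(w^i,w^j). -/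
/-- The bilinear form on finitely supported signed measures induced by a kernel `k`. -/
noncomputable def kernelForm {E : Type*} (k : E → E → ℝ) : LinearMap.BilinForm ℝ (E →₀ ℝ) :=
  Finsupp.linearCombination ℝ fun x => Finsupp.linearCombination ℝ (k x)

/-- The signed measure with mass `c i` at `p i`. -/
noncomputable def pointMasses {E ι : Type*} [Fintype ι] (p : ι → E) (c : ι → ℝ) : E →₀ ℝ :=
  ∑ i, Finsupp.single (p i) (c i)

theorem kernelForm_pointMasses {E ι κ : Type*} [Fintype ι] [Fintype κ] (k : E → E → ℝ)
    (p : ι → E) (c : ι → ℝ) (q : κ → E) (d : κ → ℝ) :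
    kernelForm k (pointMasses p c) (pointMasses q d) =
      ∑ i, ∑ j, c i * d j * k (p i) (q j) := by
  rw [Finset.sum_comm]
  simp [kernelForm, pointMasses, mul_assoc]

theorem exists_fin_pointMasses {E : Type*} (μ : E →₀ ℝ) :
    ∃ (P : ℕ) (p : Fin P → E) (c : Fin P → ℝ), pointMasses p c = μ := by
  refine ⟨_, fun i => (μ.support.equivFin.symm i : E), fun i => μ (μ.support.equivFin.symm i), ?_⟩
  rw [pointMasses,
    μ.support.equivFin.symm.sum_comp fun y : μ.support => Finsupp.single (y : E) (μ y),
    Finset.sum_coe_sort μ.support fun y => Finsupp.single y (μ y)]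
  exact μ.sum_single

theorem kernelForm_self_nonneg {E : Type*} {k : E → E → ℝ}
    (hpsd : ∀ (P : ℕ) (p : Fin P → E) (c : Fin P → ℝ),
      0 ≤ ∑ i, ∑ j, c i * c j * k (p i) (p j)) (μ : E →₀ ℝ) :
    0 ≤ kernelForm k μ μ := by
  obtain ⟨P, p, c, rfl⟩ := exists_fin_pointMasses μ
  rw [kernelForm_pointMasses]
  exact hpsd P p c

theorem kernelForm_comm {E : Type*} {k : E → E → ℝ} (hsymm : ∀ x y, k x y = k y x)
    (μ ν : E →₀ ℝ) : kernelForm k μ ν = kernelForm k ν μ := by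
  obtain ⟨P, p, c, rfl⟩ := exists_fin_pointMasses μ
  obtain ⟨Q, q, d, rfl⟩ := exists_fin_pointMasses ν
  rw [kernelForm_pointMasses, kernelForm_pointMasses, Finset.sum_comm]
  refine Finset.sum_congr rfl fun j _ => Finset.sum_congr rfl fun i _ => ?_
  rw [hsymm, mul_comm (c i)]


/-- Averaged error estimate for kernel interpolation on a test tuple `Z`:
`((1/N_z) Σ_n (f(zⁿ) - f_k(zⁿ)))² ≤ d_k(X,Z)² ‖f‖_k²`, where `f` lies in the span of
kernel translates, `f_k` is its kernel interpolant on `X`, `d_k(X,Z)` is the kernel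
discrepancy (MMD) between the tuples `X` and `Z`, and `‖f‖_k` is the kernel norm. -/
theorem stmt_7 (D N M Nz : ℕ) (hN : 0 < N) (hNz : 0 < Nz)
    (k : EuclideanSpace ℝ (Fin D) → EuclideanSpace ℝ (Fin D) → ℝ)
    (hsymm : ∀ x y, k x y = k y x)
    (hpsd : ∀ (P : ℕ) (p : Fin P → EuclideanSpace ℝ (Fin D)) (c : Fin P → ℝ),
      0 ≤ ∑ i, ∑ j, c i * c j * k (p i) (p j))
    (x : Fin N → EuclideanSpace ℝ (Fin D))
    (w : Fin M → EuclideanSpace ℝ (Fin D)) (c : Fin M → ℝ)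
    (K : Matrix (Fin N) (Fin N) ℝ) (hK : ∀ i j, K i j = k (x i) (x j))
    (hKinv : IsUnit K.det)
    (f : EuclideanSpace ℝ (Fin D) → ℝ) (hf : ∀ z, f z = ∑ j, c j * k z (w j))
    (a : Fin N → ℝ) (ha : a = K⁻¹.mulVec fun i => f (x i))
    (fk : EuclideanSpace ℝ (Fin D) → ℝ) (hfk : ∀ z, fk z = ∑ i, a i * k z (x i))
    (Z : Fin Nz → EuclideanSpace ℝ (Fin D)) :
    ((1 / (Nz : ℝ)) * ∑ n, (f (Z n) - fk (Z n))) ^ 2 ≤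
      ((1 / (N : ℝ) ^ 2) * (∑ i, ∑ j, k (x i) (x j))
          + (1 / (Nz : ℝ) ^ 2) * (∑ n, ∑ m, k (Z n) (Z m))
          - (2 / ((N : ℝ) * (Nz : ℝ))) * ∑ i, ∑ n, k (x i) (Z n))
        * ∑ i, ∑ j, c i * c j * k (w i) (w j) := by
  set B := kernelForm k
  have hB : ∀ μ, 0 ≤ B μ μ := kernelForm_self_nonneg hpsd
  have hBc : ∀ μ ν, B μ ν = B ν μ := kernelForm_comm hsymm
  set F := pointMasses w c
  set A := pointMasses x a
  set U := pointMasses x fun _ => (1 / (N : ℝ))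
  set V := pointMasses Z fun _ => (1 / (Nz : ℝ))
  have hinterp : ∀ i, fk (x i) = f (x i) := by
    have h : K.mulVec a = fun i => f (x i) := by
      rw [ha, Matrix.mulVec_mulVec, Matrix.mul_nonsing_inv _ hKinv, Matrix.one_mulVec]
    intro i
    rw [hfk, ← congrFun h i]
    simp only [Matrix.mulVec, dotProduct, hK]
    exact Finset.sum_congr rfl fun j _ => mul_comm _ _
  have hpair : ∀ {ι : Type} [Fintype ι] (q : ι → EuclideanSpace ℝ (Fin D)) (d : ι → ℝ),
      B (pointMasses q d) (F - A) = ∑ i, d i * (f (q i) - fk (q i)) := by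
    intro ι _ q d
    simp only [B, F, A, map_sub, kernelForm_pointMasses, hf, hfk, mul_sub, Finset.sum_sub_distrib,
      Finset.mul_sum, mul_assoc]
  have hX : ∀ d : Fin N → ℝ, B (pointMasses x d) (F - A) = 0 := fun d => by
    simp [hpair, hinterp]
  have hlhs : (1 / (Nz : ℝ)) * ∑ n, (f (Z n) - fk (Z n)) = B (V - U) (F - A) := by
    rw [map_sub B, LinearMap.sub_apply, hX, hpair, sub_zero, Finset.mul_sum]
  have hdisc : (1 / (N : ℝ) ^ 2) * (∑ i, ∑ j, k (x i) (x j))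
          + (1 / (Nz : ℝ) ^ 2) * (∑ n, ∑ m, k (Z n) (Z m))
          - (2 / ((N : ℝ) * (Nz : ℝ))) * ∑ i, ∑ n, k (x i) (Z n) = B (V - U) (V - U) := by
    simp only [map_sub, LinearMap.sub_apply, hBc V U]
    simp only [B, U, V, kernelForm_pointMasses, ← Finset.mul_sum]
    ring
  have hnorm : B (F - A) (F - A) ≤ B F F := by
    have h0 : B A (F - A) = 0 := hX a
    have h1 := hB A
    simp only [map_sub, LinearMap.sub_apply, hBc F A] at h0 ⊢
    linarith
  have hF : ∑ i, ∑ j, c i * c j * k (w i) (w j) = B F F :=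
    (kernelForm_pointMasses k w c w c).symm
  rw [hlhs, hdisc, hF]
  exact (LinearMap.BilinForm.apply_sq_le_of_symm B hB ⟨hBc⟩ _ _).trans
    (mul_le_mul_of_nonneg_left hnorm (hB _))
end

section
/- Let D ≥ 1 and let μ, ν be Borel probability measures on ℝ^D. Write E(ρ,η) = ∫∫ exp(−‖x−y‖²) dρ(x) dη(y). If E(μ,μ) + E(ν,ν) − 2E(μ,ν) = 0, then μ = ν. In other words, the kernel discrepancy associated with the Gaussian kernel is a distance-defining (characteristic) functional on probability measures: it vanishes only when the two measures coincide. -/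
open MeasureTheory

section GaussianKernel

open Complex ComplexConjugate InnerProductSpace

variable {V : Type*} [NormedAddCommGroup V] [InnerProductSpace ℝ V] [FiniteDimensional ℝ V]
  [MeasurableSpace V] [BorelSpace V]

theorem integrable_exp_neg_quarter_norm_sq :
    Integrable (fun t : V ↦ (Real.exp (-(1 / 4) * ‖t‖ ^ 2) : ℂ)) := by
  have := GaussianFourier.integrable_cexp_neg_mul_sq_norm_add (V := V) (b := 1 / 4)
    (by norm_num) 0 0
  simpa using this

theorem integrable_gaussian_mul_charFun_mul_conj (ρ η : Measure V) [IsProbabilityMeasure ρ]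
    [IsProbabilityMeasure η] :
    Integrable (fun t : V ↦ (Real.exp (-(1 / 4) * ‖t‖ ^ 2) : ℂ) *
      (charFun ρ t * conj (charFun η t))) := by
  refine integrable_exp_neg_quarter_norm_sq.mul_bdd (c := 1) ?_ (ae_of_all _ fun t ↦ ?_)
  · exact (measurable_charFun.mul
      (continuous_conj.measurable.comp measurable_charFun)).aestronglyMeasurable
  · rw [norm_mul, RCLike.norm_conj]
    exact mul_le_one₀ (norm_charFun_le_one t) (norm_nonneg _) (norm_charFun_le_one t)

theorem integrable_gaussianKernel (ρ η : Measure V) [IsProbabilityMeasure ρ]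
    [IsProbabilityMeasure η] :
    Integrable (fun p : V × V ↦ Real.exp (-‖p.1 - p.2‖ ^ 2)) (ρ.prod η) := by
  refine .of_bound (C := 1) (by fun_prop) (ae_of_all _ fun p ↦ ?_)
  rw [Real.norm_eq_abs, Real.abs_exp, Real.exp_le_one_iff]
  exact neg_nonpos.2 (sq_nonneg _)

/-- The Gaussian kernel energy is, up to a constant, a Gaussian-weighted `L²` pairing of
characteristic functions. -/
theorem integral_gaussianKernel_eq_integral_charFun (ρ η : Measure V) [IsProbabilityMeasure ρ]
    [IsProbabilityMeasure η] :
    (Real.pi / (1 / 4 : ℂ)) ^ (Module.finrank ℝ V / 2 : ℂ) *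
        ((∫ x, ∫ y, Real.exp (-‖x - y‖ ^ 2) ∂η ∂ρ : ℝ) : ℂ) =
      ∫ t : V, (Real.exp (-(1 / 4) * ‖t‖ ^ 2) : ℂ) * (charFun ρ t * conj (charFun η t)) := by
  have hint : Integrable (Function.uncurry fun (p : V × V) (t : V) ↦
      (Real.exp (-(1 / 4) * ‖t‖ ^ 2) : ℂ) * cexp (inner ℝ (p.1 - p.2) t * I))
      ((ρ.prod η).prod volume) := by
    refine (integrable_exp_neg_quarter_norm_sq.comp_snd _).mul_bdd (c := 1)
      (by fun_prop) (ae_of_all _ fun p ↦ ?_)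
    rw [norm_exp_ofReal_mul_I]
  rw [integral_integral (f := fun x y ↦ Real.exp (-‖x - y‖ ^ 2)) (integrable_gaussianKernel ρ η),
    ← integral_complex_ofReal, ← integral_const_mul]
  calc
    _ = ∫ p : V × V, (∫ t : V, (Real.exp (-(1 / 4) * ‖t‖ ^ 2) : ℂ) *
        cexp (inner ℝ (p.1 - p.2) t * I)) ∂(ρ.prod η) := by
      refine integral_congr_ae (ae_of_all _ fun p ↦ ?_)
      have := GaussianFourier.integral_cexp_neg_mul_sq_norm_add (V := V) (b := 1 / 4)
        (by norm_num) I (p.1 - p.2)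
      simp only [ofReal_exp, ← Complex.exp_add]
      convert! this.symm using 3
      · simp
      · push_cast; ring_nf
    _ = ∫ t : V, ∫ p : V × V, (Real.exp (-(1 / 4) * ‖t‖ ^ 2) : ℂ) *
        cexp (inner ℝ (p.1 - p.2) t * I) ∂(ρ.prod η) := integral_integral_swap hint
    _ = _ := by
      refine integral_congr_ae (ae_of_all _ fun t ↦ ?_)
      simp only [integral_const_mul]
      rw [← charFun_neg, charFun_apply, charFun_apply, ← integral_prod_mul]
      simp only [← Complex.exp_add, inner_sub_left, inner_neg_right, ofReal_sub, ofReal_neg,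
        sub_mul, neg_mul, ← sub_eq_add_neg]

theorem eq_of_gaussianKernel_discrepancy_eq_zero (μ ν : Measure V) [IsProbabilityMeasure μ]
    [IsProbabilityMeasure ν]
    (h : (∫ x, ∫ y, Real.exp (-‖x - y‖ ^ 2) ∂μ ∂μ) + (∫ x, ∫ y, Real.exp (-‖x - y‖ ^ 2) ∂ν ∂ν)
      - 2 * ∫ x, ∫ y, Real.exp (-‖x - y‖ ^ 2) ∂ν ∂μ = 0) : μ = ν := by
  have key := congrArg (fun r : ℝ ↦
    (Real.pi / (1 / 4 : ℂ)) ^ (Module.finrank ℝ V / 2 : ℂ) * (r : ℂ)) h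
  simp only [ofReal_sub, ofReal_add, ofReal_mul, ofReal_ofNat, ofReal_zero, mul_zero, mul_sub,
    mul_add, mul_left_comm _ (2 : ℂ), integral_gaussianKernel_eq_integral_charFun] at key
  have hμμ := integrable_gaussian_mul_charFun_mul_conj μ μ
  have hνν := integrable_gaussian_mul_charFun_mul_conj ν ν
  have hμν := (integrable_gaussian_mul_charFun_mul_conj μ ν).const_mul 2
  rw [← integral_const_mul, ← integral_add' hμμ hνν,
    ← integral_sub' (hμμ.add hνν) hμν] at key
  have hre (t : V) : RCLike.re ((Real.exp (-(1 / 4) * ‖t‖ ^ 2) : ℂ) *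
        (charFun μ t * conj (charFun μ t)) +
      (Real.exp (-(1 / 4) * ‖t‖ ^ 2) : ℂ) * (charFun ν t * conj (charFun ν t)) -
      2 * ((Real.exp (-(1 / 4) * ‖t‖ ^ 2) : ℂ) * (charFun μ t * conj (charFun ν t)))) =
      Real.exp (-(1 / 4) * ‖t‖ ^ 2) * normSq (charFun μ t - charFun ν t) := by
    generalize Real.exp (-(1 / 4) * ‖t‖ ^ 2) = r
    simp [normSq_apply]
    ring
  have hint := ((hμμ.add hνν).sub hμν).re
  have hzero := integral_re ((hμμ.add hνν).sub hμν)
  simp only [Pi.add_apply, Pi.sub_apply] at hint hzero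
  simp only [Pi.add_apply, Pi.sub_apply] at key
  rw [key] at hzero
  simp only [hre] at hint hzero
  rw [map_zero, integral_eq_zero_iff_of_nonneg
    (fun t ↦ mul_nonneg (Real.exp_nonneg _) (normSq_nonneg _)) hint] at hzero
  have hae : charFun μ =ᵐ[volume] charFun ν := by
    filter_upwards [hzero] with t ht
    simpa [Real.exp_ne_zero, sub_eq_zero] using ht
  exact Measure.ext_of_charFun
    ((Continuous.ae_eq_iff_eq volume (by fun_prop) (by fun_prop)).1 hae)

end GaussianKernel

/-- The Gaussian kernel is characteristic: if the squared kernel (maximum mean) discrepancy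
between two Borel probability measures on `ℝ^D` vanishes, the measures coincide. -/
theorem stmt_8 (D : ℕ) (hD : 1 ≤ D)
    (μ ν : Measure (EuclideanSpace ℝ (Fin D)))
    [IsProbabilityMeasure μ] [IsProbabilityMeasure ν]
    (E : Measure (EuclideanSpace ℝ (Fin D)) → Measure (EuclideanSpace ℝ (Fin D)) → ℝ)
    (hE : ∀ ρ η, E ρ η = ∫ x, ∫ y, Real.exp (-‖x - y‖ ^ 2) ∂η ∂ρ)
    (h : E μ μ + E ν ν - 2 * E μ ν = 0) :
    μ = ν := by
  simp only [hE] at h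
  exact eq_of_gaussianKernel_discrepancy_eq_zero μ ν h
end

section
/- Let N ≥ 1 and let c : Fin N → Fin N → ℝ be a cost matrix. Then: (i) for every pair of potentials φ, ψ : Fin N → ℝ satisfying φ(i) − ψ(j) ≤ c(i,j) for all i, j, one has Σ_i φ(i) − Σ_j ψ(j) ≤ min_{σ ∈ S_N} Σ_i c(i,σ(i)); and (ii) there exist potentials φ, ψ : Fin N → ℝ with φ(i) − ψ(j) ≤ c(i,j) for all i, j such that Σ_i φ(i) − Σ_j ψ(j) = min_{σ ∈ S_N} Σ_i c(i,σ(i)). That is, the dual linear program of the discrete optimal transport problem attains the same optimal value as the assignment problem. -/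
/-- If the cost `w` vanishes on the diagonal and every permutation has nonnegative cost, then so
does every nonnegative circulation. -/
theorem sum_mul_nonneg_of_circulation {ι : Type*} [Fintype ι] [DecidableEq ι] {w : ι → ι → ℝ}
    (hdiag : ∀ i, w i i = 0) (hperm : ∀ σ : Equiv.Perm ι, 0 ≤ ∑ i, w i (σ i))
    {M : ι → ι → ℝ} (hM : ∀ i j, 0 ≤ M i j) (hbal : ∀ k, ∑ j, M k j = ∑ i, M i k) :
    0 ≤ ∑ i, ∑ j, w i j * M i j := by
  set s : ℝ := 1 + ∑ k, ∑ j, M k j with hs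
  have hrow (k : ι) : ∑ j, M k j ≤ ∑ k, ∑ j, M k j :=
    Finset.single_le_sum (f := fun k => ∑ j, M k j)
      (fun i _ => Finset.sum_nonneg fun j _ => hM i j) (Finset.mem_univ k)
  have hspos : 0 < s := by
    have : 0 ≤ ∑ k, ∑ j, M k j := Finset.sum_nonneg fun i _ => Finset.sum_nonneg fun j _ => hM i j
    linarith
  let D : Matrix ι ι ℝ := fun i j => s⁻¹ * (M i j + if i = j then s - ∑ l, M i l else 0)
  have hD : D ∈ doublyStochastic ℝ ι := by
    rw [mem_doublyStochastic_iff_sum]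
    refine ⟨fun i j => ?_, fun i => ?_, fun j => ?_⟩
    · refine mul_nonneg (inv_nonneg.2 hspos.le) (add_nonneg (hM i j) ?_)
      split_ifs
      · linarith [hrow i]
      · exact le_rfl
    · simp only [D, ← Finset.mul_sum, Finset.sum_add_distrib, Finset.sum_ite_eq,
        Finset.mem_univ, if_true]
      field_simp
      ring
    · simp only [D, ← Finset.mul_sum, Finset.sum_add_distrib, Finset.sum_ite_eq',
        Finset.mem_univ, if_true, hbal j]
      field_simp
      ring
  let L : Matrix ι ι ℝ →ₗ[ℝ] ℝ :=
    { toFun := fun A => ∑ i, ∑ j, w i j * A i j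
      map_add' := fun A B => by simp [mul_add, Finset.sum_add_distrib]
      map_smul' := fun a A => by simp [Finset.mul_sum, mul_left_comm] }
  have hsub : (doublyStochastic ℝ ι : Set (Matrix ι ι ℝ)) ⊆ {A | 0 ≤ L A} := by
    rw [doublyStochastic_eq_convexHull_permMatrix]
    refine convexHull_min ?_ (convex_halfSpace_ge L.isLinear 0)
    rintro _ ⟨σ, rfl⟩
    simpa [L, Equiv.Perm.permMatrix, PEquiv.toMatrix_apply] using hperm σ
  have hLD : L D = s⁻¹ * ∑ i, ∑ j, w i j * M i j := by
    simp [L, D, Finset.mul_sum, mul_add, Finset.sum_add_distrib, hdiag, mul_left_comm]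
  have h0 : 0 ≤ L D := hsub hD
  rw [hLD] at h0
  exact nonneg_of_mul_nonneg_right h0 (inv_pos.2 hspos)

/-- The nonnegative flows carrying one unit from `i` to `r`. -/
def unitFlows {ι : Type*} [Fintype ι] [DecidableEq ι] (r i : ι) : Set (ι → ι → ℝ) :=
  {M | (∀ a b, 0 ≤ M a b) ∧
    ∀ k, ∑ b, M k b - ∑ a, M a k =
      Pi.single (M := fun _ => ℝ) i 1 k - Pi.single (M := fun _ => ℝ) r 1 k}

theorem add_single_mem_unitFlows {ι : Type*} [Fintype ι] [DecidableEq ι] {r j : ι}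
    {M : ι → ι → ℝ} (hM : M ∈ unitFlows r j) (i : ι) :
    M + Pi.single i (Pi.single j 1) ∈ unitFlows r i := by
  refine ⟨fun a b => add_nonneg (hM.1 a b) ?_, fun k => ?_⟩
  · simp only [Pi.single_apply]
    split_ifs <;> simp [Pi.single_apply]
    split_ifs <;> simp
  · have h := hM.2 k
    have h1 : ∑ b, (Pi.single i (Pi.single j 1) : ι → ι → ℝ) k b
        = Pi.single (M := fun _ => ℝ) i 1 k := by
      by_cases hk : k = i
      · subst hk; simp
      · simp [hk]
    have h2 : ∑ a, (Pi.single i (Pi.single j 1) : ι → ι → ℝ) a k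
        = Pi.single (M := fun _ => ℝ) j 1 k := by
      rw [← Finset.sum_apply, Finset.sum_pi_single']
      simp
    simp only [Pi.add_apply, Finset.sum_add_distrib, h1, h2]
    linarith

theorem sum_mul_add_single {ι : Type*} [Fintype ι] [DecidableEq ι] (w M : ι → ι → ℝ) (i j : ι) :
    ∑ a, ∑ b, w a b * (M + Pi.single i (Pi.single j 1) : ι → ι → ℝ) a b
      = w i j + ∑ a, ∑ b, w a b * M a b := by
  have h : ∑ a, ∑ b, w a b * (Pi.single i (Pi.single j 1) : ι → ι → ℝ) a b = w i j := by
    rw [Finset.sum_eq_single i]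
    · simp [Pi.single_apply]
    · intro a _ ha
      simp [ha]
    · simp
  simp only [Pi.add_apply, mul_add, Finset.sum_add_distrib, h]
  ring

/-- A cost vanishing on the diagonal for which every permutation has nonnegative cost admits a
potential. -/
theorem exists_potential {ι : Type*} [Fintype ι] [DecidableEq ι] {w : ι → ι → ℝ}
    (hdiag : ∀ i, w i i = 0) (hperm : ∀ σ : Equiv.Perm ι, 0 ≤ ∑ i, w i (σ i)) :
    ∃ p : ι → ℝ, ∀ i j, p i - p j ≤ w i j := by
  rcases isEmpty_or_nonempty ι with _ | ⟨⟨r⟩⟩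
  · exact ⟨0, fun i => isEmptyElim i⟩
  let cost : (ι → ι → ℝ) → ℝ := fun M => ∑ a, ∑ b, w a b * M a b
  have hzero : (0 : ι → ι → ℝ) ∈ unitFlows r r := ⟨by simp, by simp⟩
  have hbdd (i : ι) : BddBelow (cost '' unitFlows r i) := by
    refine ⟨-w r i, ?_⟩
    rintro _ ⟨M, hM, rfl⟩
    obtain ⟨hnn, hbal⟩ := add_single_mem_unitFlows hM r
    have h := sum_mul_nonneg_of_circulation hdiag hperm hnn
      fun k => sub_eq_zero.1 ((hbal k).trans (sub_self _))
    rw [sum_mul_add_single] at h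
    change -w r i ≤ ∑ a, ∑ b, w a b * M a b
    linarith
  refine ⟨fun i => sInf (cost '' unitFlows r i), fun i j => ?_⟩
  have hj : (cost '' unitFlows r j).Nonempty :=
    ⟨_, _, add_single_mem_unitFlows hzero j, rfl⟩
  have key : sInf (cost '' unitFlows r i) - w i j ≤ sInf (cost '' unitFlows r j) := by
    refine le_csInf hj ?_
    rintro _ ⟨M, hM, rfl⟩
    have h := csInf_le (hbdd i) ⟨_, add_single_mem_unitFlows hM i, rfl⟩
    have h' : cost (M + Pi.single i (Pi.single j 1)) = w i j + cost M :=
      sum_mul_add_single w M i j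
    linarith
  change sInf (cost '' unitFlows r i) - sInf (cost '' unitFlows r j) ≤ w i j
  linarith


/-- Linear programming duality for the assignment problem: (i) weak duality for every
feasible pair of potentials, and (ii) existence of a feasible pair of potentials attaining
the optimal assignment value. -/
theorem stmt_10 (N : ℕ) (hN : 1 ≤ N) (c : Fin N → Fin N → ℝ) :
    (∀ φ ψ : Fin N → ℝ, (∀ i j, φ i - ψ j ≤ c i j) →
      ∑ i, φ i - ∑ j, ψ j ≤ ⨅ σ : Equiv.Perm (Fin N), ∑ i, c i (σ i)) ∧
    (∃ φ ψ : Fin N → ℝ, (∀ i j, φ i - ψ j ≤ c i j) ∧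
      ∑ i, φ i - ∑ j, ψ j = ⨅ σ : Equiv.Perm (Fin N), ∑ i, c i (σ i)) := by
  refine ⟨fun φ ψ h => le_ciInf fun σ => ?_, ?_⟩
  · rw [← Equiv.sum_comp σ ψ, ← Finset.sum_sub_distrib]
    exact Finset.sum_le_sum fun i _ => h i (σ i)
  · obtain ⟨σ, hσ⟩ := exists_eq_ciInf_of_finite
      (f := fun σ : Equiv.Perm (Fin N) => ∑ i, c i (σ i))
    have hmin (τ : Equiv.Perm (Fin N)) : ∑ i, c i (σ i) ≤ ∑ i, c i (τ i) :=
      hσ.trans_le (ciInf_le (Set.finite_range _).bddBelow τ)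
    obtain ⟨p, hp⟩ := exists_potential (w := fun i j => c i (σ j) - c i (σ i)) (by simp)
      fun τ => by
        rw [Finset.sum_sub_distrib]
        exact sub_nonneg.2 (hmin (τ.trans σ))
    refine ⟨fun i => p i + c i (σ i), fun j => p (σ.symm j), fun i j => ?_, ?_⟩
    · have h := hp i (σ.symm j)
      rw [σ.apply_symm_apply] at h
      linarith
    · rw [← hσ, Finset.sum_add_distrib, Equiv.sum_comp σ.symm p]
      ring
end

section
/- Let E be a real inner product space and A : E → E a linear map satisfying ⟪A v, v⟫ ≤ 0 for all v ∈ E. Let τ > 0 and 1/2 ≤ θ ≤ 1, and suppose u₀, u₁ ∈ E satisfy the θ-scheme relation u₁ − u₀ = τ • A(θ • u₁ + (1−θ) • u₀). Then ‖u₁‖ ≤ ‖u₀‖. In particular the θ-scheme with θ ≥ 1/2 is unconditionally energy dissipative for negative semidefinite operators A. -/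
open RealInnerProductSpace

/-- Unconditional energy dissipation of the θ-scheme with `θ ≥ 1/2` for a negative
semidefinite operator `A`. -/
theorem stmt_12 {E : Type*} [NormedAddCommGroup E] [InnerProductSpace ℝ E]
    (A : E →ₗ[ℝ] E) (hA : ∀ v : E, ⟪A v, v⟫ ≤ 0)
    (τ θ : ℝ) (hτ : 0 < τ) (hθ1 : 1 / 2 ≤ θ) (hθ2 : θ ≤ 1)
    (u₀ u₁ : E) (h : u₁ - u₀ = τ • A (θ • u₁ + (1 - θ) • u₀)) :
    ‖u₁‖ ≤ ‖u₀‖ := by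
  have hle : ⟪u₁ - u₀, θ • u₁ + (1 - θ) • u₀⟫ ≤ 0 := by
    rw [h, real_inner_smul_left]
    exact mul_nonpos_of_nonneg_of_nonpos hτ.le (hA _)
  have hexpand : ⟪u₁ - u₀, θ • u₁ + (1 - θ) • u₀⟫ =
      (‖u₁‖ ^ 2 - ‖u₀‖ ^ 2) / 2 + (θ - 1 / 2) * ‖u₁ - u₀‖ ^ 2 := by
    rw [norm_sub_sq_real]
    simp only [inner_sub_left, inner_add_right, real_inner_smul_right,
      real_inner_self_eq_norm_sq, real_inner_comm u₁ u₀]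
    ring
  have hnonneg : 0 ≤ (θ - 1 / 2) * ‖u₁ - u₀‖ ^ 2 :=
    mul_nonneg (sub_nonneg.mpr hθ1) (sq_nonneg _)
  exact pow_le_pow_iff_left₀ (norm_nonneg _) (norm_nonneg _) two_ne_zero |>.mp (by linarith)
end

section
/- Let D ≥ 1, let f : ℝ → ℝ^D be continuously differentiable (the flux), let μ₀ : ℝ^D → ℝ be continuously differentiable (the initial data), and let T > 0. Define y : ℝ × ℝ^D → ℝ^D by y(t,x) = x + t • f'(μ₀(x)). Suppose g : (0,T) × ℝ^D → ℝ^D is differentiable (jointly in (t,x)) and satisfies g(t, y(t,x)) = x and y(t, g(t,x)) = x for all t ∈ (0,T) and x ∈ ℝ^D. Then the function μ(t,x) := μ₀(g(t,x)) is a classical solution of the scalar conservation law: for all t ∈ (0,T) and x ∈ ℝ^D, ∂_t μ(t,x) + Σ_{d=1}^D ∂_{x_d}[ f_d(μ(t,x)) ] = 0. -/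
/-- The characteristic method yields a classical solution of the scalar conservation law
`∂_t μ + ∇·f(μ) = 0`: if for each `t ∈ (0,T)` the characteristic map
`y(t,x) = x + t f'(μ₀(x))` has a (jointly differentiable) two-sided inverse `g(t,·)`, then
`μ(t,x) := μ₀(g(t,x))` satisfies the conservation law pointwise on `(0,T) × ℝ^D`. -/
theorem stmt_14 (D : ℕ) (hD : 1 ≤ D) (T : ℝ) (hT : 0 < T)
    (f : ℝ → EuclideanSpace ℝ (Fin D)) (hf : ContDiff ℝ 1 f)
    (μ₀ : EuclideanSpace ℝ (Fin D) → ℝ) (hμ₀ : ContDiff ℝ 1 μ₀)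
    (y : ℝ → EuclideanSpace ℝ (Fin D) → EuclideanSpace ℝ (Fin D))
    (hy : ∀ t x, y t x = x + t • deriv f (μ₀ x))
    (g : ℝ × EuclideanSpace ℝ (Fin D) → EuclideanSpace ℝ (Fin D))
    (hg : ∀ t ∈ Set.Ioo (0 : ℝ) T, ∀ x, DifferentiableAt ℝ g (t, x))
    (hgy : ∀ t ∈ Set.Ioo (0 : ℝ) T, ∀ x, g (t, y t x) = x)
    (hyg : ∀ t ∈ Set.Ioo (0 : ℝ) T, ∀ x, y t (g (t, x)) = x) :
    ∀ t ∈ Set.Ioo (0 : ℝ) T, ∀ x : EuclideanSpace ℝ (Fin D),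
      deriv (fun s => μ₀ (g (s, x))) t
        + ∑ d : Fin D,
            fderiv ℝ (fun z : EuclideanSpace ℝ (Fin D) => f (μ₀ (g (t, z))) d) x
              (EuclideanSpace.single d 1) = 0 := by
  intro t ht x
  set x₀ := g (t, x)
  set v := deriv f (μ₀ x₀) with hv
  have hx : x₀ + t • v = x := by rw [hv, ← hy, hyg t ht x]
  have hm : DifferentiableAt ℝ (fun p => μ₀ (g p)) (t, x) :=
    (hμ₀.differentiable one_ne_zero (g (t, x))).comp (t, x) (hg t ht x)
  obtain ⟨L, hL⟩ := hm
  have htime : HasDerivAt (fun s => μ₀ (g (s, x))) (L (1, 0)) t :=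
    HasFDerivAt.comp_hasDerivAt (f := fun s : ℝ => (s, x)) t hL
      ((hasDerivAt_id t).prodMk (hasDerivAt_const t x))
  have hspace : HasFDerivAt (fun z => μ₀ (g (t, z)))
      (L.comp (ContinuousLinearMap.inr ℝ ℝ (EuclideanSpace ℝ (Fin D)))) x :=
    HasFDerivAt.comp (f := fun z => (t, z)) x hL (hasFDerivAt_prodMk_right t x)
  have hchar : L (1, v) = 0 := by
    have hline : HasDerivAt (fun s : ℝ => (s, x₀ + s • v)) ((1 : ℝ), v) t := by
      refine (hasDerivAt_id t).prodMk ?_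
      simpa using ((hasDerivAt_id t).smul_const v).const_add x₀
    have hL' : HasFDerivAt (fun p => μ₀ (g p)) L (t, x₀ + t • v) := by rwa [hx]
    have hcomp : HasDerivAt (fun s : ℝ => μ₀ (g (s, x₀ + s • v))) (L (1, v)) t :=
      HasFDerivAt.comp_hasDerivAt (f := fun s : ℝ => (s, x₀ + s • v)) t hL' hline
    have hconst : (fun s : ℝ => μ₀ (g (s, x₀ + s • v))) =ᶠ[nhds t] fun _ => μ₀ x₀ := by
      filter_upwards [isOpen_Ioo.mem_nhds ht] with s hs
      rw [hv, ← hy, hgy s hs]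
    exact hcomp.unique ((hasDerivAt_const t (μ₀ x₀)).congr_of_eventuallyEq hconst)
  have hflux (d : Fin D) :
      fderiv ℝ (fun z => f (μ₀ (g (t, z))) d) x (EuclideanSpace.single d 1)
        = v d * L (0, EuclideanSpace.single d 1) := by
    have hf' : HasDerivAt f v (μ₀ (g (t, x))) :=
      (hf.differentiable one_ne_zero _).hasDerivAt
    have hfd : HasDerivAt (fun u => f u d) (v d) (μ₀ (g (t, x))) :=
      (EuclideanSpace.proj (𝕜 := ℝ) d).hasFDerivAt.comp_hasDerivAt _ hf'
    have hcomp : HasFDerivAt (fun z => f (μ₀ (g (t, z))) d)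
        (v d • L.comp (ContinuousLinearMap.inr ℝ ℝ (EuclideanSpace ℝ (Fin D)))) x :=
      HasDerivAt.comp_hasFDerivAt (h₂ := fun u => f u d) x hfd hspace
    rw [hcomp.fderiv]
    simp
  have hsum : ∑ d, v d * L (0, EuclideanSpace.single d 1) = L (0, v) := by
    have hdecomp : v = ∑ d, v d • EuclideanSpace.single d (1 : ℝ) := by
      simpa using ((EuclideanSpace.basisFun (Fin D) ℝ).sum_repr v).symm
    let M := L.comp (ContinuousLinearMap.inr ℝ ℝ (EuclideanSpace ℝ (Fin D)))
    change ∑ d, v d * M (EuclideanSpace.single d 1) = M v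
    conv_rhs => rw [hdecomp]
    simp [map_sum]
  rw [htime.deriv, Finset.sum_congr rfl fun d _ => hflux d, hsum, ← map_add]
  simpa using hchar
end
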